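/- Let ρ be a quantum state on a composite system X_1 ⊗ … ⊗ X_n ⊗ Y of finite-dimensional systems, and let μ, m be integers with 1 ≤ μ < m ≤ n. Then E_{|I|=m} S(X_I|Y)_ρ ≤ (m/μ) · E_{|J|=μ} S(X_J|Y)_ρ, where both expectations are uniform averages over subsets of {1,…,n} of the indicated cardinality. -/

import Mathlib

open scoped BigOperators ComplexOrder

/-- Von Neumann entropy of a matrix: `-∑ λ_j log λ_j` over the eigenvalues,
if the matrix is Hermitian (else junk value 0). Natural logarithm,
with the convention `0 * log 0 = 0` (automatic since `Real.log 0 = 0`). -/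
noncomputable def vnEntropy {m : Type*} [Fintype m] [DecidableEq m]
    (ρ : Matrix m m ℂ) : ℝ :=
  if h : ρ.IsHermitian then
    -∑ j, h.eigenvalues j * Real.log (h.eigenvalues j)
  else 0

/-- Marginal (partial trace) of a state on the composite system
`⨂_{i : ι} X_i` (with `X_i = ℂ^{dim i}`), keeping the factors in `S`. -/
noncomputable def marginal {ι : Type*} [Fintype ι] [DecidableEq ι]
    {dim : ι → ℕ}
    (ρ : Matrix ((i : ι) → Fin (dim i)) ((i : ι) → Fin (dim i)) ℂ)
    (S : Finset ι) :
    Matrix ((i : {j : ι // j ∈ S}) → Fin (dim i.1))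
           ((i : {j : ι // j ∈ S}) → Fin (dim i.1)) ℂ :=
  fun x y =>
    ∑ z : (i : {j : ι // j ∉ S}) → Fin (dim i.1),
      ρ (fun i => if h : i ∈ S then x ⟨i, h⟩ else z ⟨i, h⟩)
        (fun i => if h : i ∈ S then y ⟨i, h⟩ else z ⟨i, h⟩)

/-- Entropy of the marginal of `ρ` on the factors in `S`. -/
noncomputable def mEnt {ι : Type*} [Fintype ι] [DecidableEq ι]
    {dim : ι → ℕ}
    (ρ : Matrix ((i : ι) → Fin (dim i)) ((i : ι) → Fin (dim i)) ℂ)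
    (S : Finset ι) : ℝ :=
  vnEntropy (marginal ρ S)


open Filter Topology Matrix

lemma hder {K : Type*} [Fintype K] (w p q : K → ℝ) (hp : ∀ k, 0 ≤ p k)
    (hq : ∀ k, 0 < q k) (T : ℝ) (hT : 0 ≤ T) :
    HasDerivAt (fun T => ∑ k, w k * (p k * (Real.log (q k + T * p k) - Real.log (q k))))
      (∑ k, w k * (p k ^ 2 / (q k + T * p k))) T := by
  apply HasDerivAt.fun_sum
  intro k _
  have h0 : q k + T * p k ≠ 0 := by
    have := hp k; have := hq k; positivity
  have h1 : HasDerivAt (fun T : ℝ => q k + T * p k) (p k) T := by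
    simpa using ((hasDerivAt_id T).mul_const (p k)).const_add (q k)
  have h2 := (((h1.log h0).sub_const (Real.log (q k))).const_mul (p k)).const_mul (w k)
  refine h2.congr_deriv ?_
  ring

lemma hlim {K : Type*} [Fintype K] (w p q : K → ℝ) (hp : ∀ k, 0 ≤ p k)
    (hq : ∀ k, 0 < q k) :
    Tendsto (fun T => ∑ k, w k * (p k * (Real.log (q k + T * p k) - Real.log (q k)))
      - (∑ k, w k * p k) * Real.log T) atTop
      (𝓝 (∑ k, w k * (p k * (Real.log (p k) - Real.log (q k))))) := by
  simp only [Finset.sum_mul, ← Finset.sum_sub_distrib]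
  apply tendsto_finsetSum
  intro k _
  rcases (hp k).eq_or_lt with h0 | h0
  · simp [← h0]
  · have h1 : Tendsto (fun T : ℝ => q k / T + p k) atTop (𝓝 (p k)) := by
      simpa using (tendsto_const_nhds.div_atTop tendsto_id).add_const (p k)
    have h2 := (((h1.log h0.ne').sub_const (Real.log (q k))).const_mul (p k)).const_mul (w k)
    refine h2.congr' ?_
    filter_upwards [eventually_gt_atTop 0] with T hT
    have hq := hq k
    have : q k / T + p k = (q k + T * p k) / T := by field_simp
    rw [this, Real.log_div (by positivity) hT.ne']
    ring

lemma scalar_mono {K K' : Type*} [Fintype K] [Fintype K'] (w p q : K → ℝ) (w' p' q' : K' → ℝ)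
    (hp : ∀ k, 0 ≤ p k) (hq : ∀ k, 0 < q k) (hp' : ∀ k, 0 ≤ p' k) (hq' : ∀ k, 0 < q' k)
    (hs : ∑ k, w k * p k = ∑ k, w' k * p' k)
    (h : ∀ t, 0 < t → ∑ k, w' k * (p' k ^ 2 / (q' k + t * p' k))
      ≤ ∑ k, w k * (p k ^ 2 / (q k + t * p k))) :
    ∑ k, w' k * (p' k * (Real.log (p' k) - Real.log (q' k)))
      ≤ ∑ k, w k * (p k * (Real.log (p k) - Real.log (q k))) := by
  have hD : MonotoneOn (fun T =>
      ∑ k, w k * (p k * (Real.log (q k + T * p k) - Real.log (q k)))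
      - ∑ k, w' k * (p' k * (Real.log (q' k + T * p' k) - Real.log (q' k)))) (Set.Ici 0) := by
    have hd := fun T hT => (hder w p q hp hq T hT).sub (hder w' p' q' hp' hq' T hT)
    apply monotoneOn_of_deriv_nonneg (convex_Ici 0)
    · exact fun T hT => (hd T hT).continuousAt.continuousWithinAt
    · intro T hT
      rw [interior_Ici] at hT
      exact (hd T (le_of_lt hT)).differentiableAt.differentiableWithinAt
    · intro T hT
      rw [interior_Ici] at hT
      have := (hd T (le_of_lt hT)).deriv
      have h3 := h T hT
      refine le_of_le_of_eq ?_ this.symm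
      linarith
  have hl := (hlim w p q hp hq).sub (hlim w' p' q' hp' hq')
  rw [← sub_nonneg]
  refine ge_of_tendsto hl ?_
  filter_upwards [eventually_gt_atTop 0] with T hT
  have := hD (Set.mem_Ici.2 le_rfl) (Set.mem_Ici.2 hT.le) hT.le
  simp at this
  rw [hs]; linarith

section
variable {N : Type*} [Fintype N] [DecidableEq N]

lemma quad_eq (U V Y : Matrix N N ℂ) (p q : N → ℝ) (hU : Uᴴ * U = 1) (hV : Vᴴ * V = 1) (t : ℝ) :
    2 * (trace ((V * Y * Uᴴ)ᴴ * (U * diagonal (fun i => (p i : ℂ)) * Uᴴ))).re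
      - (trace ((V * Y * Uᴴ) * (V * Y * Uᴴ)ᴴ * (V * diagonal (fun i => (q i : ℂ)) * Vᴴ))).re
      - t * (trace ((V * Y * Uᴴ)ᴴ * (V * Y * Uᴴ) * (U * diagonal (fun i => (p i : ℂ)) * Uᴴ))).re
    = ∑ j, ∑ i, (2 * (star (Y j i) * (Vᴴ * U) j i).re * p i
        - (q j + t * p i) * Complex.normSq (Y j i)) := by
  have e1 : trace ((V * Y * Uᴴ)ᴴ * (U * diagonal (fun i => (p i : ℂ)) * Uᴴ))
      = trace (Yᴴ * (Vᴴ * U * diagonal (fun i => (p i : ℂ)))) := by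
    rw [conjTranspose_mul, conjTranspose_mul, conjTranspose_conjTranspose, trace_mul_comm]
    have : U * diagonal (fun i => (p i : ℂ)) * Uᴴ * (U * (Yᴴ * Vᴴ))
      = U * (diagonal (fun i => (p i : ℂ)) * ((Uᴴ * U) * (Yᴴ * Vᴴ))) := by
      simp only [Matrix.mul_assoc]
    rw [this, hU, Matrix.one_mul, trace_mul_comm, Matrix.mul_assoc, trace_mul_comm]
    simp only [Matrix.mul_assoc]
  have e2 : trace ((V * Y * Uᴴ) * (V * Y * Uᴴ)ᴴ * (V * diagonal (fun i => (q i : ℂ)) * Vᴴ))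
      = trace (Yᴴ * (diagonal (fun i => (q i : ℂ)) * Y)) := by
    rw [conjTranspose_mul, conjTranspose_mul, conjTranspose_conjTranspose]
    have : V * Y * Uᴴ * (U * (Yᴴ * Vᴴ)) * (V * diagonal (fun i => (q i : ℂ)) * Vᴴ)
      = V * (Y * ((Uᴴ * U) * (Yᴴ * ((Vᴴ * V) * (diagonal (fun i => (q i : ℂ)) * Vᴴ))))) := by
      simp only [Matrix.mul_assoc]
    rw [this, hU, hV, Matrix.one_mul, Matrix.one_mul, trace_mul_comm]
    have : Y * (Yᴴ * (diagonal (fun i => (q i : ℂ)) * Vᴴ)) * V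
      = Y * (Yᴴ * (diagonal (fun i => (q i : ℂ)) * (Vᴴ * V))) := by
      simp only [Matrix.mul_assoc]
    rw [this, hV, Matrix.mul_one, trace_mul_comm, Matrix.mul_assoc]
  have e3 : trace ((V * Y * Uᴴ)ᴴ * (V * Y * Uᴴ) * (U * diagonal (fun i => (p i : ℂ)) * Uᴴ))
      = trace (Yᴴ * (Y * diagonal (fun i => (p i : ℂ)))) := by
    rw [conjTranspose_mul, conjTranspose_mul, conjTranspose_conjTranspose]
    have : U * (Yᴴ * Vᴴ) * (V * Y * Uᴴ) * (U * diagonal (fun i => (p i : ℂ)) * Uᴴ)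
      = U * (Yᴴ * ((Vᴴ * V) * (Y * ((Uᴴ * U) * (diagonal (fun i => (p i : ℂ)) * Uᴴ))))) := by
      simp only [Matrix.mul_assoc]
    rw [this, hU, hV, Matrix.one_mul, Matrix.one_mul, trace_mul_comm]
    have : Yᴴ * (Y * (diagonal (fun i => (p i : ℂ)) * Uᴴ)) * U
      = Yᴴ * (Y * (diagonal (fun i => (p i : ℂ)) * (Uᴴ * U))) := by
      simp only [Matrix.mul_assoc]
    rw [this, hU, Matrix.mul_one]
  rw [e1, e2, e3]
  have tr : ∀ Z : Matrix N N ℂ, trace (Yᴴ * Z) = ∑ j, ∑ i, star (Y j i) * Z j i := by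
    intro Z
    rw [Finset.sum_comm]
    simp [trace, Matrix.mul_apply]
  simp only [tr, mul_diagonal, diagonal_mul, Complex.re_sum, Finset.mul_sum,
    ← Finset.sum_sub_distrib]
  refine Finset.sum_congr rfl fun j _ => Finset.sum_congr rfl fun i _ => ?_
  simp [Complex.normSq_apply]
  ring

lemma key_upper (U V X : Matrix N N ℂ) (p q : N → ℝ) (hU : Uᴴ * U = 1) (hV : Vᴴ * V = 1)
    (hp : ∀ k, 0 ≤ p k) (hq : ∀ k, 0 < q k) (t : ℝ) (ht : 0 < t) :
    2 * (trace (Xᴴ * (U * diagonal (fun i => (p i : ℂ)) * Uᴴ))).re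
      - (trace (X * Xᴴ * (V * diagonal (fun i => (q i : ℂ)) * Vᴴ))).re
      - t * (trace (Xᴴ * X * (U * diagonal (fun i => (p i : ℂ)) * Uᴴ))).re
    ≤ ∑ k : N × N, Complex.normSq ((Vᴴ * U) k.1 k.2) * (p k.2 ^ 2 / (q k.1 + t * p k.2)) := by
  have hX : X = V * (Vᴴ * X * U) * Uᴴ := by
    have : V * (Vᴴ * X * U) * Uᴴ = (V * Vᴴ) * X * (U * Uᴴ) := by simp only [Matrix.mul_assoc]
    rw [this, mul_eq_one_comm.1 hU, mul_eq_one_comm.1 hV, Matrix.one_mul, Matrix.mul_one]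
  rw [hX, quad_eq _ _ _ _ _ hU hV, Fintype.sum_prod_type]
  generalize Vᴴ * X * U = Y
  refine Finset.sum_le_sum fun j _ => Finset.sum_le_sum fun i _ => ?_
  generalize (Vᴴ * U) j i = W
  generalize Y j i = y
  have hp := hp i
  have hq := hq j
  have hs : 0 < q j + t * p i := by positivity
  rw [← mul_div_assoc, le_div_iff₀ hs]
  simp only [Complex.normSq_apply, Complex.mul_re, Complex.star_def, Complex.conj_re,
    Complex.conj_im]
  nlinarith [sq_nonneg ((q j + t * p i) * y.re - p i * W.re),
    sq_nonneg ((q j + t * p i) * y.im - p i * W.im)]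

lemma key_attain (U V : Matrix N N ℂ) (p q : N → ℝ) (hU : Uᴴ * U = 1) (hV : Vᴴ * V = 1)
    (hp : ∀ k, 0 ≤ p k) (hq : ∀ k, 0 < q k) (t : ℝ) (ht : 0 < t) : ∃ X : Matrix N N ℂ,
    2 * (trace (Xᴴ * (U * diagonal (fun i => (p i : ℂ)) * Uᴴ))).re
      - (trace (X * Xᴴ * (V * diagonal (fun i => (q i : ℂ)) * Vᴴ))).re
      - t * (trace (Xᴴ * X * (U * diagonal (fun i => (p i : ℂ)) * Uᴴ))).re
    = ∑ k : N × N, Complex.normSq ((Vᴴ * U) k.1 k.2) * (p k.2 ^ 2 / (q k.1 + t * p k.2)) := by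
  refine ⟨V * (Matrix.of fun j i => ((p i / (q j + t * p i) : ℝ) : ℂ) * (Vᴴ * U) j i) * Uᴴ, ?_⟩
  rw [quad_eq _ _ _ _ _ hU hV, Fintype.sum_prod_type]
  refine Finset.sum_congr rfl fun j _ => Finset.sum_congr rfl fun i _ => ?_
  rw [Matrix.of_apply]
  generalize (Vᴴ * U) j i = W
  have hp := hp i
  have hq := hq j
  have hs : 0 < q j + t * p i := by positivity
  have e : star (((p i / (q j + t * p i) : ℝ) : ℂ) * W) * W
     = ((p i / (q j + t * p i) * Complex.normSq W : ℝ) : ℂ) := by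
    rw [Complex.ofReal_mul (p i / (q j + t * p i)) (Complex.normSq W), Complex.normSq_eq_conj_mul_self]
    rw [Complex.star_def, map_mul, Complex.conj_ofReal]
    ring
  rw [e, Complex.ofReal_re, Complex.normSq_mul, Complex.normSq_ofReal]
  field_simp
  ring

lemma sum_w_right (U V : Matrix N N ℂ) (hU : Uᴴ * U = 1) (hV : Vᴴ * V = 1) (i : N) :
    ∑ j, Complex.normSq ((Vᴴ * U) j i) = 1 := by
  have h : (Vᴴ * U)ᴴ * (Vᴴ * U) = 1 := by
    rw [conjTranspose_mul, conjTranspose_conjTranspose, Matrix.mul_assoc, ← Matrix.mul_assoc V,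
      mul_eq_one_comm.1 hV, Matrix.one_mul, hU]
  have h1 := congrFun (congrFun h i) i
  rw [Matrix.mul_apply, one_apply_eq] at h1
  have h2 := congrArg Complex.re h1
  rw [Complex.re_sum, Complex.one_re] at h2
  rw [← h2]
  refine Finset.sum_congr rfl fun j _ => ?_
  rw [conjTranspose_apply, Complex.star_def, ← Complex.normSq_eq_conj_mul_self, Complex.ofReal_re]

lemma sum_w_left (U V : Matrix N N ℂ) (p : N → ℝ) (j : N) :
    ∑ i, Complex.normSq ((Vᴴ * U) j i) * p i
      = ((Vᴴ * (U * diagonal (fun i => (p i : ℂ)) * Uᴴ) * V) j j).re := by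
  have : Vᴴ * (U * diagonal (fun i => (p i : ℂ)) * Uᴴ) * V
      = (Vᴴ * U) * diagonal (fun i => (p i : ℂ)) * (Vᴴ * U)ᴴ := by
    rw [conjTranspose_mul, conjTranspose_conjTranspose]; simp only [Matrix.mul_assoc]
  rw [this]
  generalize Vᴴ * U = W
  rw [Matrix.mul_apply, Complex.re_sum]
  refine Finset.sum_congr rfl fun i _ => ?_
  rw [mul_diagonal, conjTranspose_apply, Complex.normSq_apply]
  simp
  ring
end

open scoped Kronecker

lemma rel_exp {N : Type*} [Fintype N] [DecidableEq N] (U V : Matrix N N ℂ) (p : N → ℝ)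
    (hU : Uᴴ * U = 1) (hV : Vᴴ * V = 1) (f g : N → ℝ) :
    ∑ k : N × N, Complex.normSq ((Vᴴ * U) k.1 k.2) * (p k.2 * (f k.2 - g k.1))
    = ∑ i, p i * f i
      - ∑ j, ((Vᴴ * (U * diagonal (fun i => (p i : ℂ)) * Uᴴ) * V) j j).re * g j := by
  simp only [← sum_w_left, mul_sub, Finset.sum_sub_distrib]
  congr 1
  · rw [Fintype.sum_prod_type_right]
    refine Finset.sum_congr rfl fun i _ => ?_
    dsimp only
    rw [← Finset.sum_mul, sum_w_right U V hU hV, one_mul]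
  · rw [Fintype.sum_prod_type]
    refine Finset.sum_congr rfl fun i _ => ?_
    rw [Finset.sum_mul]
    refine Finset.sum_congr rfl fun j _ => ?_
    ring

lemma tr_diag {N : Type*} [Fintype N] [DecidableEq N] (U : Matrix N N ℂ) (p : N → ℝ)
    (hU : Uᴴ * U = 1) :
    (trace (U * diagonal (fun i => (p i : ℂ)) * Uᴴ)).re = ∑ i, p i := by
  rw [trace_mul_comm, ← Matrix.mul_assoc, hU, Matrix.one_mul, trace_diagonal, Complex.re_sum]
  simp

lemma rel_mono {N M : Type*} [Fintype N] [DecidableEq N] [Fintype M] [DecidableEq M]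
    (E : Matrix M M ℂ → Matrix N N ℂ) (hE1 : E 1 = 1) (hEm : ∀ X Y, E (X * Y) = E X * E Y)
    (hEs : ∀ X, E Xᴴ = (E X)ᴴ)
    (ρ σ : Matrix N N ℂ) (ρ' σ' : Matrix M M ℂ)
    (hρ : ∀ X, trace (E X * ρ) = trace (X * ρ')) (hσ : ∀ X, trace (E X * σ) = trace (X * σ'))
    (U V : Matrix N N ℂ) (p q : N → ℝ) (hU : Uᴴ * U = 1) (hV : Vᴴ * V = 1)
    (hp : ∀ k, 0 ≤ p k) (hq : ∀ k, 0 < q k)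
    (U' V' : Matrix M M ℂ) (p' q' : M → ℝ) (hU' : U'ᴴ * U' = 1) (hV' : V'ᴴ * V' = 1)
    (hp' : ∀ k, 0 ≤ p' k) (hq' : ∀ k, 0 < q' k)
    (eρ : ρ = U * diagonal (fun i => (p i : ℂ)) * Uᴴ)
    (eσ : σ = V * diagonal (fun i => (q i : ℂ)) * Vᴴ)
    (eρ' : ρ' = U' * diagonal (fun i => (p' i : ℂ)) * U'ᴴ)
    (eσ' : σ' = V' * diagonal (fun i => (q' i : ℂ)) * V'ᴴ) :
    ∑ i, p' i * Real.log (p' i) - ∑ j, ((V'ᴴ * ρ' * V') j j).re * Real.log (q' j)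
    ≤ ∑ i, p i * Real.log (p i) - ∑ j, ((Vᴴ * ρ * V) j j).re * Real.log (q j) := by
  subst eρ eσ eρ' eσ'
  rw [← rel_exp U V p hU hV, ← rel_exp U' V' p' hU' hV']
  refine scalar_mono _ (fun k : N × N => p k.2) (fun k => q k.1) _ (fun k : M × M => p' k.2)
    (fun k => q' k.1) (fun k => hp _) (fun k => hq _) (fun k => hp' _) (fun k => hq' _) ?_ ?_
  · have h1 := rel_exp U V p hU hV (fun _ => 1) (fun _ => 0)
    have h2 := rel_exp U' V' p' hU' hV' (fun _ => 1) (fun _ => 0)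
    simp only [sub_zero, mul_one, mul_zero, Finset.sum_const_zero] at h1 h2
    rw [h1, h2, ← tr_diag U p hU, ← tr_diag U' p' hU']
    have := hρ 1
    rw [hE1, Matrix.one_mul, Matrix.one_mul] at this
    rw [this]
  · intro t ht
    obtain ⟨X, hX⟩ := key_attain U' V' p' q' hU' hV' hp' hq' t ht
    rw [← hX, ← hρ, ← hρ, ← hσ, hEm, hEm, hEs]
    exact key_upper U V (E X) p q hU hV hp hq t ht

lemma exists_spectral {N : Type*} [Fintype N] [DecidableEq N] (A : Matrix N N ℂ)
    (hA : A.IsHermitian) : ∃ U : Matrix N N ℂ, Uᴴ * U = 1 ∧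
      A = U * diagonal (fun i => (hA.eigenvalues i : ℂ)) * Uᴴ := by
  refine ⟨hA.eigenvectorUnitary, ?_, ?_⟩
  · rw [← star_eq_conjTranspose]
    exact Unitary.coe_star_mul_self _
  · exact hA.spectral_theorem

lemma vn_eq {N : Type*} [Fintype N] [DecidableEq N] (A : Matrix N N ℂ) (hA : A.IsHermitian) :
    vnEntropy A = - ∑ j, hA.eigenvalues j * Real.log (hA.eigenvalues j) := dif_pos hA

lemma vn_submatrix {N M : Type*} [Fintype N] [DecidableEq N] [Fintype M] [DecidableEq M]
    (A : Matrix N N ℂ) (hA : A.IsHermitian) (e : M ≃ N) :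
    vnEntropy (A.submatrix e e) = vnEntropy A := by
  have hB : (A.submatrix e e).IsHermitian := hA.submatrix e
  have hc : (A.submatrix e e).charpoly = A.charpoly := by
    have := charpoly_reindex e.symm A
    simpa [reindex_apply] using this
  have h := hB.roots_charpoly_eq_eigenvalues
  rw [hc, hA.roots_charpoly_eq_eigenvalues] at h
  have h2 := congrArg (fun s : Multiset ℂ => (s.map (fun z => z.re * Real.log z.re)).sum) h
  simp only [Multiset.map_map, Function.comp_def] at h2
  rw [vn_eq _ hA, vn_eq _ hB]
  simp only [Finset.sum]
  simpa using h2.symm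

section SSA
variable {A B C : Type*} [Fintype A] [DecidableEq A] [Fintype B] [DecidableEq B]
  [Fintype C] [DecidableEq C]

lemma kron_diag {P : Type*} [Fintype P] [DecidableEq P] (V : Matrix P P ℂ) (r : P → ℝ) (δ : ℝ)
    (hV : Vᴴ * V = 1) :
    (V * diagonal (fun i => (r i : ℂ)) * Vᴴ + (δ : ℂ) • 1) ⊗ₖ (1 : Matrix C C ℂ)
    = (V ⊗ₖ (1 : Matrix C C ℂ)) * diagonal (fun i : P × C => ((r i.1 + δ : ℝ) : ℂ))
      * (V ⊗ₖ (1 : Matrix C C ℂ))ᴴ := by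
  have h1 : V * diagonal (fun i => (r i : ℂ)) * Vᴴ + (δ : ℂ) • 1
      = V * diagonal (fun i => ((r i + δ : ℝ) : ℂ)) * Vᴴ := by
    have : diagonal (fun i => ((r i + δ : ℝ) : ℂ)) = diagonal (fun i => (r i : ℂ)) + (δ : ℂ) • 1 := by
      ext i j
      by_cases h : i = j
      · subst h; simp
      · simp [h]
    rw [this, Matrix.mul_add, Matrix.add_mul, Matrix.mul_smul, Matrix.smul_mul, Matrix.mul_one,
      mul_eq_one_comm.1 hV]
  have h2 : diagonal (fun i : P × C => ((r i.1 + δ : ℝ) : ℂ))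
      = diagonal (fun i => ((r i + δ : ℝ) : ℂ)) ⊗ₖ (1 : Matrix C C ℂ) := by
    rw [← diagonal_one, diagonal_kronecker_diagonal]; simp
  rw [h1, h2, conjTranspose_kronecker, conjTranspose_one, ← mul_kronecker_mul, ← mul_kronecker_mul]
  simp

lemma kron_unitary {P : Type*} [Fintype P] [DecidableEq P] (V : Matrix P P ℂ)
    (hV : Vᴴ * V = 1) :
    (V ⊗ₖ (1 : Matrix C C ℂ))ᴴ * (V ⊗ₖ (1 : Matrix C C ℂ)) = 1 := by
  rw [conjTranspose_kronecker, conjTranspose_one, ← mul_kronecker_mul, hV]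
  simp

lemma kron_cross {P : Type*} [Fintype P] [DecidableEq P] (τ : Matrix (P × C) (P × C) ℂ)
    (V : Matrix P P ℂ) (r : P → ℝ) (g : P → ℝ) (hV : Vᴴ * V = 1)
    (h : (Matrix.of fun x y => ∑ c, τ (x, c) (y, c)) = V * diagonal (fun i => (r i : ℂ)) * Vᴴ) :
    ∑ j, (((V ⊗ₖ (1 : Matrix C C ℂ))ᴴ * τ * (V ⊗ₖ (1 : Matrix C C ℂ))) j j).re * g j.1
      = ∑ x, r x * g x := by
  rw [Fintype.sum_prod_type]
  refine Finset.sum_congr rfl fun x _ => ?_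
  dsimp only
  rw [← Finset.sum_mul, ← Complex.re_sum]
  congr 1
  have h2 : Vᴴ * (Matrix.of fun x y => ∑ c, τ (x, c) (y, c)) * V = diagonal (fun i => (r i : ℂ)) := by
    rw [h]
    have : Vᴴ * (V * diagonal (fun i => (r i : ℂ)) * Vᴴ) * V
      = (Vᴴ * V) * diagonal (fun i => (r i : ℂ)) * (Vᴴ * V) := by simp only [Matrix.mul_assoc]
    rw [this, hV]; simp
  have h3 := congrFun (congrFun h2 x) x
  rw [diagonal_apply_eq] at h3
  rw [← Complex.ofReal_re (r x), ← h3]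
  congr 1
  simp only [Matrix.mul_apply, Fintype.sum_prod_type, conjTranspose_apply, kroneckerMap_apply,
    Matrix.one_apply, Matrix.of_apply]
  simp [Finset.sum_mul, Finset.mul_sum]
  rw [Finset.sum_comm]
  refine Finset.sum_congr rfl fun y _ => ?_
  rw [Finset.sum_comm]
  refine Finset.sum_congr rfl fun y' _ => ?_
  simp [apply_ite (starRingEnd ℂ), ite_mul]

lemma E_trace (X : Matrix (B × C) (B × C) ℂ) (τ : Matrix ((A × B) × C) ((A × B) × C) ℂ) :
    trace ((((1 : Matrix A A ℂ) ⊗ₖ X).submatrix (Equiv.prodAssoc A B C) (Equiv.prodAssoc A B C)) * τ)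
    = trace (X * Matrix.of fun x y => ∑ a, τ ((a, x.1), x.2) ((a, y.1), y.2)) := by
  simp only [trace, diag_apply, Matrix.mul_apply, Fintype.sum_prod_type, submatrix_apply,
    kroneckerMap_apply, Matrix.one_apply, Equiv.prodAssoc_apply, Matrix.of_apply, Finset.mul_sum]
  simp only [ite_mul, one_mul, zero_mul]
  have key : ∀ (x : A) (f : A → B → C → ℂ),
      (∑ a, ∑ b, ∑ c, if x = a then f a b c else 0) = ∑ b, ∑ c, f x b c := by
    intro x f
    rw [Finset.sum_eq_single x]
    · simp
    · intro b _ hb; simp [hb.symm]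
    · simp
  simp only [fun (x : A) (x1 : B) (x2 : C) => key x
    (fun a b c => X (x1, x2) (b, c) * τ ((a, b), c) ((x, x1), x2))]
  rw [Finset.sum_comm]
  refine Finset.sum_congr rfl fun _ _ => ?_
  rw [Finset.sum_comm]
  refine Finset.sum_congr rfl fun _ _ => ?_
  rw [Finset.sum_comm]
  refine Finset.sum_congr rfl fun _ _ => ?_
  rw [Finset.sum_comm]

lemma lim_log {K : Type*} [Fintype K] (r : K → ℝ) (hr : ∀ k, 0 ≤ r k) (d : ℝ) :
    Tendsto (fun δ : ℝ => ∑ j, r j * Real.log (r j + d * δ)) (𝓝[>] 0)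
      (𝓝 (∑ j, r j * Real.log (r j))) := by
  apply tendsto_finsetSum
  intro k _
  rcases (hr k).eq_or_lt with h0 | h0
  · simp [← h0]
  · have h1 : Tendsto (fun δ : ℝ => r k + d * δ) (𝓝[>] 0) (𝓝 (r k)) := by
      have : Continuous (fun δ : ℝ => r k + d * δ) := by fun_prop
      simpa using (this.tendsto 0).mono_left nhdsWithin_le_nhds
    exact (h1.log h0.ne').const_mul _

lemma ssa_prod [Nonempty A] (ρ : Matrix ((A × B) × C) ((A × B) × C) ℂ) (hρ : ρ.PosSemidef) :
    vnEntropy ρ + vnEntropy (Matrix.of fun x y : B => ∑ a, ∑ c, ρ ((a, x), c) ((a, y), c))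
    ≤ vnEntropy (Matrix.of fun x y : A × B => ∑ c, ρ (x, c) (y, c))
      + vnEntropy (Matrix.of fun x y : B × C => ∑ a, ρ ((a, x.1), x.2) ((a, y.1), y.2)) := by
  set ρAB := (Matrix.of fun x y : A × B => ∑ c, ρ (x, c) (y, c)) with hAB
  set ρBC := (Matrix.of fun x y : B × C => ∑ a, ρ ((a, x.1), x.2) ((a, y.1), y.2)) with hBC
  set ρB := (Matrix.of fun x y : B => ∑ a, ∑ c, ρ ((a, x), c) ((a, y), c)) with hB
  have pAB : ρAB.PosSemidef := by
    have : ρAB = ∑ c, ρ.submatrix (fun x => (x, c)) (fun x => (x, c)) := by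
      ext x y; simp [hAB, Matrix.sum_apply]
    rw [this]
    exact posSemidef_sum _ fun c _ => hρ.submatrix _
  have pBC : ρBC.PosSemidef := by
    have : ρBC = ∑ a, ρ.submatrix (fun x : B × C => ((a, x.1), x.2)) (fun x => ((a, x.1), x.2)) := by
      ext x y; simp [hBC, Matrix.sum_apply]
    rw [this]
    exact posSemidef_sum _ fun c _ => hρ.submatrix _
  have pB : ρB.PosSemidef := by
    have : ρB = ∑ a, ρAB.submatrix (fun x : B => (a, x)) (fun x => (a, x)) := by
      ext x y; simp [hB, hAB, Matrix.sum_apply]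
    rw [this]
    exact posSemidef_sum _ fun c _ => pAB.submatrix _
  rw [vn_eq _ hρ.1, vn_eq _ pAB.1, vn_eq _ pBC.1, vn_eq _ pB.1]
  obtain ⟨U, hU, eU⟩ := exists_spectral ρ hρ.1
  obtain ⟨V, hV, eV⟩ := exists_spectral ρAB pAB.1
  obtain ⟨U', hU', eU'⟩ := exists_spectral ρBC pBC.1
  obtain ⟨V', hV', eV'⟩ := exists_spectral ρB pB.1
  have nAB := pAB.eigenvalues_nonneg
  have nBC := pBC.eigenvalues_nonneg
  have nB := pB.eigenvalues_nonneg
  have nρ := hρ.eigenvalues_nonneg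
  generalize hρ.1.eigenvalues = p at *
  generalize pAB.1.eigenvalues = r at *
  generalize pBC.1.eigenvalues = p' at *
  generalize pB.1.eigenvalues = r' at *
  have cardpos : (0 : ℝ) < Fintype.card A := by exact_mod_cast Fintype.card_pos
  have main : ∀ δ : ℝ, 0 < δ → ∑ i, p' i * Real.log (p' i)
      - ∑ j, r' j * Real.log (r' j + Fintype.card A * δ)
      ≤ ∑ i, p i * Real.log (p i) - ∑ j, r j * Real.log (r j + δ) := by
    intro δ hδ
    have := rel_mono (fun X : Matrix (B × C) (B × C) ℂ => ((1 : Matrix A A ℂ) ⊗ₖ X).submatrix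
        (Equiv.prodAssoc A B C) (Equiv.prodAssoc A B C)) (by simp)
        (fun X Y => by
          rw [submatrix_mul_equiv, ← mul_kronecker_mul, Matrix.one_mul])
        (fun X => by
          rw [conjTranspose_submatrix, conjTranspose_kronecker, conjTranspose_one])
        ρ ((ρAB + (δ : ℂ) • 1) ⊗ₖ (1 : Matrix C C ℂ)) ρBC
        ((ρB + ((Fintype.card A * δ : ℝ) : ℂ) • 1) ⊗ₖ (1 : Matrix C C ℂ))
        (fun X => by rw [E_trace])
        (fun X => by
          rw [E_trace]
          congr 2
          ext x y
          simp [hAB, hB, Matrix.one_apply, Finset.sum_add_distrib])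
        U (V ⊗ₖ (1 : Matrix C C ℂ)) p (fun j => r j.1 + δ) hU (kron_unitary V hV) nρ
        (fun k => by have := nAB k.1; positivity)
        U' (V' ⊗ₖ (1 : Matrix C C ℂ)) p' (fun j => r' j.1 + Fintype.card A * δ) hU'
        (kron_unitary V' hV') nBC
        (fun k => by have := nB k.1; positivity)
        eU (by rw [eV]; exact kron_diag V r δ hV) eU'
        (by rw [eV']; exact kron_diag V' r' _ hV')
    rw [kron_cross ρ V r (fun x => Real.log (r x + δ)) hV eV,
      kron_cross ρBC V' r' (fun x => Real.log (r' x + Fintype.card A * δ)) hV'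
        (by rw [← eV']; ext x y; simp [hBC, hB]; rw [Finset.sum_comm])] at this
    exact this
  have l1 := (tendsto_const_nhds (x := ∑ i, p' i * Real.log (p' i))).sub
    (lim_log r' nB (Fintype.card A))
  have l2 := (tendsto_const_nhds (x := ∑ i, p i * Real.log (p i))).sub (lim_log r nAB 1)
  have h := le_of_tendsto_of_tendsto l1 l2 (by
    filter_upwards [self_mem_nhdsWithin] with δ hδ
    simpa using main δ hδ)
  linarith
end SSA

section Glue
variable {ι : Type*} [Fintype ι] [DecidableEq ι] {dim : ι → ℕ}

/-- Joining local configurations on disjoint index predicates. -/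
def piJoin (P Q O : ι → Prop) [DecidablePred P] (h : ∀ k, O k ↔ P k ∨ Q k)
    (hd : ∀ k, P k → ¬ Q k) :
    (((k : {k // P k}) → Fin (dim k.1)) × ((k : {k // Q k}) → Fin (dim k.1)))
      ≃ ((k : {k // O k}) → Fin (dim k.1)) where
  toFun x k := if hP : P k.1 then x.1 ⟨k.1, hP⟩
    else x.2 ⟨k.1, ((h k.1).1 k.2).resolve_left hP⟩
  invFun y := (fun k => y ⟨k.1, (h _).2 (Or.inl k.2)⟩, fun k => y ⟨k.1, (h _).2 (Or.inr k.2)⟩)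
  left_inv x := by
    refine Prod.ext ?_ ?_
    · funext k; simp [k.2]
    · funext k
      have : ¬ P k.1 := fun hP => hd _ hP k.2
      simp [this]
  right_inv y := by
    funext k
    dsimp only
    split <;> rfl

lemma marginal_psd (ρ : Matrix ((i : ι) → Fin (dim i)) ((i : ι) → Fin (dim i)) ℂ)
    (hρ : ρ.PosSemidef) (S : Finset ι) : (marginal ρ S).PosSemidef := by
  have : marginal ρ S = ∑ z : (i : {j : ι // j ∉ S}) → Fin (dim i.1),
      ρ.submatrix (fun x i => if h : i ∈ S then x ⟨i, h⟩ else z ⟨i, h⟩)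
        (fun x i => if h : i ∈ S then x ⟨i, h⟩ else z ⟨i, h⟩) := by
    ext x y; simp [marginal, Matrix.sum_apply]
  rw [this]
  exact posSemidef_sum _ fun c _ => hρ.submatrix _

lemma mEnt_eq (ρ : Matrix ((i : ι) → Fin (dim i)) ((i : ι) → Fin (dim i)) ℂ)
    (hρ : ρ.PosSemidef) (S : Finset ι) {P K : Type*} [Fintype P] [DecidableEq P] [Fintype K]
    (e : P ≃ ((i : {j : ι // j ∈ S}) → Fin (dim i.1)))
    (f : K ≃ ((i : {j : ι // j ∉ S}) → Fin (dim i.1)))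
    (g : P → K → (i : ι) → Fin (dim i))
    (hg : ∀ p k i, g p k i = if h : i ∈ S then e p ⟨i, h⟩ else f k ⟨i, h⟩) :
    vnEntropy (Matrix.of fun p p' => ∑ k, ρ (g p k) (g p' k)) = mEnt ρ S := by
  rw [mEnt, ← vn_submatrix _ (marginal_psd ρ hρ S).1 e]
  congr 1
  ext p p'
  simp only [Matrix.of_apply, submatrix_apply, marginal]
  refine Fintype.sum_equiv f _ _ fun k => ?_
  congr 1
  · funext i; exact hg p k i
  · funext i; exact hg p' k i

lemma mEnt_ssa (ρ : Matrix ((i : ι) → Fin (dim i)) ((i : ι) → Fin (dim i)) ℂ)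
    (hρ : ρ.PosSemidef) (hdim : ∀ i, 0 < dim i) (A B C : Finset ι)
    (hAB : ∀ k, k ∈ A → k ∉ B) (hAC : ∀ k, k ∈ A → k ∉ C) (hBC : ∀ k, k ∈ B → k ∉ C) :
    mEnt ρ (A ∪ B ∪ C) + mEnt ρ B ≤ mEnt ρ (A ∪ B) + mEnt ρ (B ∪ C) := by
  let T (P : ι → Prop) := (k : {k // P k}) → Fin (dim k.1)
  let R : ι → Prop := fun k => k ∉ A ∧ k ∉ B ∧ k ∉ C
  let g : T (· ∈ A) → T (· ∈ B) → T (· ∈ C) → T R → (i : ι) → Fin (dim i) :=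
    fun a b c z i => if hA : i ∈ A then a ⟨i, hA⟩ else if hB : i ∈ B then b ⟨i, hB⟩
      else if hC : i ∈ C then c ⟨i, hC⟩ else z ⟨i, hA, hB, hC⟩
  have : Nonempty (T (· ∈ A)) := ⟨fun k => ⟨0, hdim _⟩⟩
  let τ : Matrix ((T (· ∈ A) × T (· ∈ B)) × T (· ∈ C)) ((T (· ∈ A) × T (· ∈ B)) × T (· ∈ C)) ℂ :=
    Matrix.of fun x y => ∑ z, ρ (g x.1.1 x.1.2 x.2 z) (g y.1.1 y.1.2 y.2 z)
  have hτ : τ.PosSemidef := by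
    have : τ = ∑ z, ρ.submatrix (fun x => g x.1.1 x.1.2 x.2 z) (fun x => g x.1.1 x.1.2 x.2 z) := by
      ext x y; simp [τ, Matrix.sum_apply]
    rw [this]
    exact posSemidef_sum _ fun c _ => hρ.submatrix _
  have h := ssa_prod τ hτ
  let eAB : (T (· ∈ A) × T (· ∈ B)) ≃ T (· ∈ A ∪ B) := piJoin _ _ _ (by simp) hAB
  let eBC : (T (· ∈ B) × T (· ∈ C)) ≃ T (· ∈ B ∪ C) := piJoin _ _ _ (by simp) hBC
  let eABC : ((T (· ∈ A) × T (· ∈ B)) × T (· ∈ C)) ≃ T (· ∈ A ∪ B ∪ C) :=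
    (eAB.prodCongr (Equiv.refl _)).trans (piJoin _ _ _ (by simp [or_assoc]) (by grind))
  let fC : (T (· ∈ C) × T R) ≃ T (· ∉ A ∪ B) := piJoin _ _ _ (by grind) (by grind)
  let fA : (T (· ∈ A) × T R) ≃ T (· ∉ B ∪ C) := piJoin _ _ _ (by grind) (by grind)
  let f0 : T R ≃ T (· ∉ A ∪ B ∪ C) := Equiv.piCongrLeft' (fun k => Fin (dim k.1))
    (Equiv.subtypeEquivRight (by grind))
  let fAC : (T (· ∈ A) × (T (· ∈ C) × T R)) ≃ T (· ∉ B) :=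
    ((Equiv.refl _).prodCongr fC).trans (piJoin _ _ _ (by grind) (by grind))
  have h1 : vnEntropy τ = mEnt ρ (A ∪ B ∪ C) :=
    mEnt_eq ρ hρ _ eABC f0 (fun x z => g x.1.1 x.1.2 x.2 z) (by
      intro p k i
      simp only [g, eABC, eAB, f0, piJoin, Equiv.trans_apply, Equiv.prodCongr_apply,
        Equiv.coe_fn_mk, Prod.map]
      by_cases hA : i ∈ A <;> by_cases hB : i ∈ B <;> by_cases hC : i ∈ C <;> simp [hA, hB, hC] <;> rfl)
  have h2 : vnEntropy (Matrix.of fun x y => ∑ c, τ (x, c) (y, c)) = mEnt ρ (A ∪ B) := by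
    rw [← mEnt_eq ρ hρ _ eAB fC (fun x z => g x.1 x.2 z.1 z.2)]
    · simp only [τ, Matrix.of_apply, Fintype.sum_prod_type]
    · intro p k i
      simp only [g, eAB, fC, piJoin, Equiv.coe_fn_mk]
      by_cases hA : i ∈ A <;> by_cases hB : i ∈ B <;> by_cases hC : i ∈ C <;> simp [hA, hB, hC]
  have h3 : vnEntropy (Matrix.of fun x y : T (· ∈ B) × T (· ∈ C) =>
      ∑ a, τ ((a, x.1), x.2) ((a, y.1), y.2)) = mEnt ρ (B ∪ C) := by
    rw [← mEnt_eq ρ hρ _ eBC fA (fun x z => g z.1 x.1 x.2 z.2)]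
    · simp only [τ, Matrix.of_apply, Fintype.sum_prod_type]
    · intro p k i
      have := hAB i
      have := hAC i
      simp only [g, eBC, fA, piJoin, Equiv.coe_fn_mk]
      by_cases hA : i ∈ A <;> by_cases hB : i ∈ B <;> by_cases hC : i ∈ C <;> simp_all
  have h4 : vnEntropy (Matrix.of fun x y : T (· ∈ B) =>
      ∑ a, ∑ c, τ ((a, x), c) ((a, y), c)) = mEnt ρ B := by
    rw [← mEnt_eq ρ hρ _ (Equiv.refl _) fAC (fun x z => g z.1 x z.2.1 z.2.2)]
    · simp only [τ, Matrix.of_apply, Fintype.sum_prod_type]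
      rfl
    · intro p k i
      have := hAB i
      have := hAC i
      simp only [g, fAC, fC, piJoin, Equiv.coe_fn_mk, Equiv.trans_apply, Equiv.prodCongr_apply,
        Prod.map]
      by_cases hA : i ∈ A <;> by_cases hB : i ∈ B <;> by_cases hC : i ∈ C <;> simp_all
  rw [h1, h2, h3, h4] at h
  exact h
end Glue

section Han
variable {n : ℕ}

lemma perm_sum (f : Finset (Fin n) → ℝ) (S : Finset (Fin n)) :
    (n.choose S.card : ℝ) * ∑ π : Equiv.Perm (Fin n), f (S.map π.toEmbedding)
      = (Fintype.card (Equiv.Perm (Fin n)) : ℝ)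
        * ∑ I ∈ Finset.powersetCard S.card Finset.univ, f I := by
  have hc : ∀ I ∈ Finset.powersetCard S.card (Finset.univ : Finset (Fin n)),
      ∑ π : Equiv.Perm (Fin n), f (I.map π.toEmbedding)
        = ∑ π : Equiv.Perm (Fin n), f (S.map π.toEmbedding) := by
    intro I hI
    have hI := (Finset.mem_powersetCard.1 hI).2
    let e : {x // x ∈ S} ≃ {x // x ∈ I} := Fintype.equivOfCardEq (by simp [hI])
    let τ : Equiv.Perm (Fin n) := e.extendSubtype
    have hτ : S.map τ.toEmbedding = I := by
      apply Finset.eq_of_subset_of_card_le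
      · intro x hx
        obtain ⟨y, hy, rfl⟩ := Finset.mem_map.1 hx
        exact e.extendSubtype_mem y hy
      · simp [hI]
    refine Fintype.sum_equiv (Equiv.mulRight τ) _ _ fun π => ?_
    rw [← hτ, Finset.map_map]
    rfl
  have h1 : ∑ I ∈ Finset.powersetCard S.card (Finset.univ : Finset (Fin n)),
      ∑ π : Equiv.Perm (Fin n), f (I.map π.toEmbedding)
      = (n.choose S.card : ℝ) * ∑ π : Equiv.Perm (Fin n), f (S.map π.toEmbedding) := by
    rw [Finset.sum_congr rfl hc, Finset.sum_const, Finset.card_powersetCard]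
    simp
  rw [← h1, Finset.sum_comm]
  have h2 : ∀ π : Equiv.Perm (Fin n),
      ∑ I ∈ Finset.powersetCard S.card (Finset.univ : Finset (Fin n)), f (I.map π.toEmbedding)
      = ∑ I ∈ Finset.powersetCard S.card Finset.univ, f I := by
    intro π
    refine Finset.sum_equiv (Equiv.finsetCongr π) ?_ ?_
    · intro I; simp [Finset.mem_powersetCard]
    · intro I _; rfl
  simp [h2]

lemma han (f : Finset (Fin n) → ℝ) (h0 : f ∅ = 0)
    (hsub : ∀ (S : Finset (Fin n)) (i j : Fin n), i ∉ S → j ∉ S → i ≠ j →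
      f (insert i (insert j S)) + f S ≤ f (insert i S) + f (insert j S))
    (μ m : ℕ) (hμ : 1 ≤ μ) (hμm : μ < m) (hmn : m ≤ n) :
    (∑ I ∈ Finset.powersetCard m Finset.univ, f I) / (n.choose m : ℝ)
      ≤ (m : ℝ) / (μ : ℝ) * ((∑ J ∈ Finset.powersetCard μ Finset.univ, f J) / (n.choose μ : ℝ)) := by
  set a : ℕ → ℝ := fun k => (∑ I ∈ Finset.powersetCard k Finset.univ, f I) / (n.choose k : ℝ)
    with ha
  set c : ℝ := (Fintype.card (Equiv.Perm (Fin n)) : ℝ) with hcdef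
  have hc : 0 < c := by
    have : 0 < Fintype.card (Equiv.Perm (Fin n)) := Fintype.card_pos
    rw [hcdef]
    exact_mod_cast this
  have hS : ∀ S : Finset (Fin n), ∑ π : Equiv.Perm (Fin n), f (S.map π.toEmbedding)
      = c * a S.card := by
    intro S
    have hch : (0 : ℝ) < n.choose S.card := by
      exact_mod_cast Nat.choose_pos (by simpa using S.card_le_univ)
    have := perm_sum f S
    rw [ha]
    simp only
    rw [← mul_div_assoc, ← this]
    field_simp
  have ha0 : a 0 = 0 := by simp [ha, h0]
  have conc : ∀ k, k + 2 ≤ n → a (k + 2) + a k ≤ 2 * a (k + 1) := by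
    intro k hk
    obtain ⟨S, hSc⟩ : ∃ S : Finset (Fin n), S.card = k := by
      obtain ⟨S, _, h⟩ := Finset.exists_subset_card_eq (s := (Finset.univ : Finset (Fin n)))
        (n := k) (by simp; omega)
      exact ⟨S, h⟩
    obtain ⟨i, hi⟩ : ∃ i, i ∉ S := by
      by_contra! h
      have : S = Finset.univ := Finset.eq_univ_of_forall h
      rw [this] at hSc; simp at hSc; omega
    obtain ⟨j, hj⟩ : ∃ j, j ∉ insert i S := by
      by_contra! h
      have : insert i S = Finset.univ := Finset.eq_univ_of_forall h
      have h2 := Finset.card_insert_of_notMem hi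
      rw [this] at h2; simp at h2; omega
    have hjS : j ∉ S := fun h => hj (Finset.mem_insert_of_mem h)
    have hij : i ≠ j := fun h => hj (by simp [h])
    have hsum := Finset.sum_le_sum fun (π : Equiv.Perm (Fin n)) (_ : π ∈ Finset.univ) =>
      hsub (S.map π.toEmbedding) (π i) (π j) (by simpa using hi) (by simpa using hjS)
        (by simpa using hij)
    have r1 : ∀ π : Equiv.Perm (Fin n), insert (π i) (S.map π.toEmbedding)
        = (insert i S).map π.toEmbedding := by intro π; simp [Finset.map_insert]
    have r2 : ∀ π : Equiv.Perm (Fin n), insert (π j) (S.map π.toEmbedding)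
        = (insert j S).map π.toEmbedding := by intro π; simp [Finset.map_insert]
    have r3 : ∀ π : Equiv.Perm (Fin n), insert (π i) ((insert j S).map π.toEmbedding)
        = (insert i (insert j S)).map π.toEmbedding := by intro π; simp [Finset.map_insert]
    simp only [r1, r2, r3, Finset.sum_add_distrib, hS] at hsum
    have hi2 : i ∉ insert j S := by simp [hij, hi]
    rw [Finset.card_insert_of_notMem hi2, Finset.card_insert_of_notMem hi,
      Finset.card_insert_of_notMem hjS, hSc] at hsum
    have : c * (a (k + 2) + a k) ≤ c * (2 * a (k + 1)) := by
      have e : k + 1 + 1 = k + 2 := rfl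
      rw [e] at hsum; linarith
    exact le_of_mul_le_mul_left this hc
  -- k * a (k+1) ≤ (k+1) * a k
  have step : ∀ k, k + 1 ≤ n → (k : ℝ) * a (k + 1) ≤ (k + 1) * a k := by
    intro k
    induction k with
    | zero => intro _; simp [ha0]
    | succ k ih =>
      intro hk
      have h1 := ih (by omega)
      have h2 := conc k hk
      push_cast
      have hk0 : (0 : ℝ) ≤ k := Nat.cast_nonneg k
      have e : k + 1 + 1 = k + 2 := rfl
      rw [e]
      nlinarith
  have fin : ∀ m, μ ≤ m → m ≤ n → a m ≤ (m : ℝ) / μ * a μ := by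
    have hμ0 : (0 : ℝ) < μ := by exact_mod_cast hμ
    intro m hm
    induction m, hm using Nat.le_induction with
    | base => intro _; rw [div_self hμ0.ne', one_mul]
    | succ k hk ih =>
      intro hkn
      have h1 := ih (by omega)
      have h2 := step k hkn
      have hk0 : (0 : ℝ) < k := by exact_mod_cast (by omega : 0 < k)
      have : (k : ℝ) * a (k + 1) ≤ k * (((k + 1 : ℕ) : ℝ) / μ * a μ) := by
        refine h2.trans ?_
        have := mul_le_mul_of_nonneg_left h1 (by positivity : (0 : ℝ) ≤ k + 1)
        refine this.trans (le_of_eq ?_)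
        push_cast; ring
      exact le_of_mul_le_mul_left this hk0
  exact fin m hμm.le hmn
end Han

/-- conditional version of the entropy averaging inequality:
`E_{|I|=m} S(X_I|Y) ≤ (m/μ) E_{|J|=μ} S(X_J|Y)`, where `Y = Sum.inr ()`. -/
theorem avg_cond_entropy_subsets
    (n μ m : ℕ) (hμ : 1 ≤ μ) (hμm : μ < m) (hmn : m ≤ n)
    (dim : Fin n ⊕ Unit → ℕ)
    (ρ : Matrix ((i : Fin n ⊕ Unit) → Fin (dim i))
                ((i : Fin n ⊕ Unit) → Fin (dim i)) ℂ)
    (hpsd : ρ.PosSemidef) (htr : ρ.trace = 1) :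
    (∑ I ∈ Finset.powersetCard m (Finset.univ : Finset (Fin n)),
        (mEnt ρ (I.image Sum.inl ∪ ({Sum.inr ()} : Finset (Fin n ⊕ Unit)))
          - mEnt ρ ({Sum.inr ()} : Finset (Fin n ⊕ Unit))))
        / (n.choose m : ℝ)
      ≤ (m : ℝ) / (μ : ℝ) *
        ((∑ J ∈ Finset.powersetCard μ (Finset.univ : Finset (Fin n)),
          (mEnt ρ (J.image Sum.inl ∪ ({Sum.inr ()} : Finset (Fin n ⊕ Unit)))
            - mEnt ρ ({Sum.inr ()} : Finset (Fin n ⊕ Unit))))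
          / (n.choose μ : ℝ)) := by
  have hne : Nonempty ((i : Fin n ⊕ Unit) → Fin (dim i)) := by
    by_contra h
    rw [not_nonempty_iff] at h
    simp [Matrix.trace] at htr
  have hdim : ∀ i, 0 < dim i := fun i => Fin.pos (hne.some i)
  refine han (fun I => mEnt ρ (I.image Sum.inl ∪ ({Sum.inr ()} : Finset (Fin n ⊕ Unit)))
          - mEnt ρ ({Sum.inr ()} : Finset (Fin n ⊕ Unit))) (by simp) ?_ μ m hμ hμm hmn
  intro S i j hi hj hij
  have h := mEnt_ssa ρ hpsd hdim {Sum.inl i}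
    (S.image Sum.inl ∪ ({Sum.inr ()} : Finset (Fin n ⊕ Unit))) {Sum.inl j}
    (by simp [hi]) (by simp [hij]) (by rintro k hk; simp at hk ⊢; rintro rfl; simp [hj] at hk)
  have e1 : {Sum.inl i} ∪ (S.image Sum.inl ∪ ({Sum.inr ()} : Finset (Fin n ⊕ Unit))) ∪ {Sum.inl j}
    = (insert i (insert j S)).image Sum.inl ∪ {Sum.inr ()} := by ext x; simp; tauto
  have e2 : {Sum.inl i} ∪ (S.image Sum.inl ∪ ({Sum.inr ()} : Finset (Fin n ⊕ Unit)))
    = (insert i S).image Sum.inl ∪ {Sum.inr ()} := by ext x; simp; tauto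
  have e3 : (S.image Sum.inl ∪ ({Sum.inr ()} : Finset (Fin n ⊕ Unit))) ∪ {Sum.inl j}
    = (insert j S).image Sum.inl ∪ {Sum.inr ()} := by ext x; simp; tauto
  rw [e1, e2, e3] at h
  linarith
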